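/- Let (G,w) be an energy game with n = |V| and W = max_{(u,v) ∈ E} |w(u,v)|, let s be a node of G, and let (G',w') be the gadget graph obtained from (G,w) and s by replacing every edge by a five-edge construction as described. Then Alice wins at s in (G,w) if and only if Alice wins at s in (G',w'). -/

import Mathlib

/-!
Common definitions for energy games (Brim et al. style), following the paper's
definitions: a game graph is a finite directed graph in which every node has
out-degree at least one, together with a partition of the nodes into Alice's
nodes `VA` and Bob's nodes (the complement of `VA`).  Strategies are positional.
For a fixed pair of strategies the play from a node `s` is the orbit of the
induced successor function, and the minimal sufficient energy at `s` is the
least initial energy that keeps the running energy nonnegative forever, i.e.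
`⨆ i, (-(weight of the length-i prefix))⁺ ∈ ℕ∞`; this coincides with
`∞` when the reachable cycle is negative and with `max (0, -min_P w(P))`
(minimum over simple paths `P` from `s`) otherwise.
-/

open scoped BigOperators

universe u

structure GameGraph (V : Type u) [Fintype V] [DecidableEq V] where
  E : Finset (V × V)
  VA : Finset V
  exists_succ : ∀ v : V, ∃ u : V, (v, u) ∈ E

namespace GameGraph

variable {V : Type u} [Fintype V] [DecidableEq V]

/-- Positional strategies of Alice: a choice of an out-edge at every node of Alice. -/
def AliceStrategy (G : GameGraph V) : Type u :=
  {σ : V → V // ∀ u ∈ G.VA, (u, σ u) ∈ G.E}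

/-- Positional strategies of Bob: a choice of an out-edge at every node of Bob. -/
def BobStrategy (G : GameGraph V) : Type u :=
  {τ : V → V // ∀ u : V, u ∉ G.VA → (u, τ u) ∈ G.E}

/-- The successor function of `G(σ,τ)`, the graph in which every node keeps only the
out-edge chosen by its owner's strategy. -/
def play (G : GameGraph V) (σ : G.AliceStrategy) (τ : G.BobStrategy) (v : V) : V :=
  if v ∈ G.VA then σ.1 v else τ.1 v

/-- Total weight of the length-`i` prefix of the unique path from `s` in the
functional graph with successor function `f`. -/
def prefixWeight (w : V → V → ℤ) (f : V → V) (s : V) (i : ℕ) : ℤ :=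
  ∑ j ∈ Finset.range i, w (f^[j] s) (f^[j + 1] s)

/-- The minimal sufficient energy `e*_{G(σ,τ),w}(s)` at `s` for a fixed pair of
strategies with induced successor function `f`:  the least initial energy
(in `ℕ∞ = ℤ≥0 ∪ {∞}`) keeping the running energy nonnegative forever.  It is `∞`
iff the unique cycle reachable from `s` is negative, and `max (0, -min_P w(P))`
(minimum over simple paths from `s`) otherwise. -/
noncomputable def stratEnergy (w : V → V → ℤ) (f : V → V) (s : V) : ℕ∞ :=
  ⨆ i : ℕ, ((-(prefixWeight w f s i)).toNat : ℕ∞)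

/-- The minimal sufficient energy `e*_{G,w}(s) = min_σ max_τ e*_{G(σ,τ),w}(s)`. -/
noncomputable def minEnergy (G : GameGraph V) (w : V → V → ℤ) (s : V) : ℕ∞ :=
  ⨅ σ : G.AliceStrategy, ⨆ τ : G.BobStrategy, stratEnergy w (G.play σ τ) s

/-- Alice wins at `s` iff the minimal sufficient energy at `s` is finite. -/
noncomputable def AliceWins (G : GameGraph V) (w : V → V → ℤ) (s : V) : Prop :=
  G.minEnergy w s ≠ ⊤

/-- The canonical embedding `ℕ∞ = ℤ≥0 ∪ {∞} → ℤ ∪ {∞}` (extended arithmetic: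
`∞ + x = ∞`, `∞ ≥ x`). -/
def toZInf (x : ℕ∞) : WithTop ℤ :=
  if x = ⊤ then ⊤ else ((x.toNat : ℤ) : WithTop ℤ)

/-- `max (x - z, 0)` for `x : ℕ∞` and `z : ℤ`, with `∞ - z = ∞`. -/
def esub (x : ℕ∞) (z : ℤ) : ℕ∞ :=
  if x = ⊤ then ⊤ else ((((x.toNat : ℤ) - z).toNat : ℕ) : ℕ∞)

/-- The successors of `u` in `G`. -/
def succs (G : GameGraph V) (u : V) : Finset V :=
  (G.E.filter (fun p => p.1 = u)).image Prod.snd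

/-- The weight function with every weight rounded up to the nearest multiple of `B`:
`w_B(u,v) = ⌈w(u,v)/B⌉·B`. -/
def roundW (w : V → V → ℤ) (B : ℤ) : V → V → ℤ :=
  fun u v => ⌈(w u v : ℚ) / (B : ℚ)⌉ * B

/-- `W = max_{(u,v) ∈ E} |w(u,v)|`. -/
def maxAbsW (G : GameGraph V) (w : V → V → ℤ) : ℕ :=
  G.E.sup (fun p => (w p.1 p.2).natAbs)

/-- A strategy `τ` of Bob is optimal if `e*_{G(σ,τ),w}(s) ≥ e*_{G,w}(s)` for every
node `s` and every strategy `σ` of Alice. -/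
noncomputable def IsOptimalBob (G : GameGraph V) (w : V → V → ℤ) (τ : G.BobStrategy) : Prop :=
  ∀ (s : V) (σ : G.AliceStrategy), G.minEnergy w s ≤ stratEnergy w (G.play σ τ) s

/-- Total weight of the cycle of length `L` through `x` in the functional graph `f`. -/
def cycleWeight (w : V → V → ℤ) (f : V → V) (x : V) (L : ℕ) : ℤ :=
  ∑ j ∈ Finset.range L, w (f^[j] x) (f^[j + 1] x)

/-- A node `s` has penalty at least `D ≥ 0` if there is an optimal strategy `τ*` of Bob
such that for every strategy `σ` of Alice the unique cycle `C` reachable from `s` in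
`G(σ,τ*)` satisfies: if `w(C) < 0` then the average weight `w(C)/|C|` is at most `-D`.
(The cycle is described by any node `x` on it, reachable from `s`, together with its
minimal period `L`.) -/
noncomputable def HasPenaltyAtLeast (G : GameGraph V) (w : V → V → ℤ) (s : V) (D : ℝ) : Prop :=
  ∃ τ : G.BobStrategy, G.IsOptimalBob w τ ∧
    ∀ σ : G.AliceStrategy, ∀ x : V, (∃ i : ℕ, (G.play σ τ)^[i] s = x) →
      ∀ L : ℕ, 0 < L → (G.play σ τ)^[L] x = x →
        (∀ k : ℕ, 0 < k → k < L → (G.play σ τ)^[k] x ≠ x) →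
        cycleWeight w (G.play σ τ) x L < 0 →
        ((cycleWeight w (G.play σ τ) x L : ℝ) / (L : ℝ) ≤ -D)

end GameGraph

namespace GameGraph

variable {V : Type u} [Fintype V] [DecidableEq V]

/-- The edges of `G`, as a type. -/
abbrev EdgeSub (G : GameGraph V) : Type u := {p : V × V // p ∈ G.E}

/-- The node type of the gadget graph: the original nodes, plus for every edge
`e = (x,y)` of `G` a new Alice node `u_e` (left) and a new Bob node `v_e` (right). -/
abbrev GadgetV (G : GameGraph V) : Type u := V ⊕ (EdgeSub G ⊕ EdgeSub G)

/-- Edges of the gadget graph: every edge `e = (x,y)` of `G` is replaced by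
`(x, u_e)`, `(u_e, v_e)`, `(v_e, y)`, and the two back edges `(u_e, s)`, `(v_e, s)`. -/
def gadgetEdge (G : GameGraph V) (s : V) : GadgetV G × GadgetV G → Bool
  | (Sum.inl x, Sum.inr (Sum.inl e)) => decide (e.1.1 = x)
  | (Sum.inr (Sum.inl e), Sum.inr (Sum.inr e')) => decide (e = e')
  | (Sum.inr (Sum.inl _), Sum.inl y) => decide (y = s)
  | (Sum.inr (Sum.inr e), Sum.inl y) => decide (e.1.2 = y ∨ y = s)
  | _ => false

/-- The gadget game graph `G'` obtained from `(G, w)` and the designated node `s`. -/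
def gadget (G : GameGraph V) (s : V) : GameGraph (GadgetV G) where
  E := Finset.univ.filter (fun q => gadgetEdge G s q = true)
  VA := Finset.univ.filter (fun a : GadgetV G =>
    (match a with
      | Sum.inl x => decide (x ∈ G.VA)
      | Sum.inr (Sum.inl _) => true
      | Sum.inr (Sum.inr _) => false) = true)
  exists_succ := by
    rintro (x | e | e)
    · obtain ⟨y, hy⟩ := G.exists_succ x
      exact ⟨Sum.inr (Sum.inl ⟨(x, y), hy⟩), by
        simp [gadgetEdge]⟩
    · exact ⟨Sum.inr (Sum.inr e), by simp [gadgetEdge]⟩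
    · exact ⟨Sum.inl e.1.2, by simp [gadgetEdge]⟩

/-- The weights of the gadget graph: `w'(x, u_e) = w(x,y)` for `e = (x,y)`,
`w'(u_e, v_e) = 0`, `w'(v_e, y) = 0`, `w'(u_e, s) = -nW` and `w'(v_e, s) = nW`,
where `n = |V|` and `W = max_{(u,v) ∈ E} |w(u,v)|`. -/
def gadgetW (G : GameGraph V) (w : V → V → ℤ) (s : V) :
    GadgetV G → GadgetV G → ℤ := fun a b =>
  match a, b with
  | Sum.inl _, Sum.inr (Sum.inl e) => w e.1.1 e.1.2
  | Sum.inr (Sum.inl _), Sum.inl _ =>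
      -((Fintype.card V : ℤ) * (G.maxAbsW w : ℤ))
  | Sum.inr (Sum.inr e), Sum.inl y =>
      if y = e.1.2 then 0 else (Fintype.card V : ℤ) * (G.maxAbsW w : ℤ)
  | _, _ => 0

end GameGraph

namespace GameGraph

variable {V : Type u} [Fintype V] [DecidableEq V]

/-! ### Energies along a functional graph -/

theorem prefixWeight_add {X : Type*} (w : X → X → ℤ) (f : X → X) (s : X) (i j : ℕ) :
    prefixWeight w f s (i + j) = prefixWeight w f s i + prefixWeight w f (f^[i] s) j := by
  simp only [prefixWeight, Finset.sum_range_add]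
  congr 1
  refine Finset.sum_congr rfl fun k _ => ?_
  rw [← Function.iterate_add_apply, ← Function.iterate_add_apply]
  congr 2 <;> omega

theorem prefixWeight_succ {X : Type*} (w : X → X → ℤ) (f : X → X) (s : X) (i : ℕ) :
    prefixWeight w f s (i + 1) = prefixWeight w f s i + w (f^[i] s) (f (f^[i] s)) := by
  rw [prefixWeight, Finset.sum_range_succ, Function.iterate_succ_apply', prefixWeight]

theorem stratEnergy_ne_top_iff {X : Type*} (w : X → X → ℤ) (f : X → X) (s : X) :
    stratEnergy w f s ≠ ⊤ ↔ ∃ B : ℤ, ∀ i, B ≤ prefixWeight w f s i := by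
  rw [stratEnergy, ENat.iSup_natCast_ne_top]
  constructor
  · rintro ⟨B, hB⟩
    refine ⟨-B, fun i => ?_⟩
    have := hB ⟨i, rfl⟩
    dsimp only at this
    omega
  · rintro ⟨B, hB⟩
    refine ⟨(-B).toNat, ?_⟩
    rintro _ ⟨i, rfl⟩
    have := hB i
    dsimp only
    omega

theorem prefixWeight_mul_of_isPeriodicPt {X : Type*} (w : X → X → ℤ) {f : X → X} {s : X}
    {L : ℕ} (hs : f^[L] s = s) (k : ℕ) :
    prefixWeight w f s (k * L) = k * prefixWeight w f s L := by
  induction k with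
  | zero => simp [prefixWeight]
  | succ k ih =>
    have hk : f^[k * L] s = s := by
      rw [mul_comm]
      exact (show Function.IsPeriodicPt f L s from hs).mul_const k
    rw [add_mul, one_mul, prefixWeight_add, hk, ih]
    push_cast
    ring

theorem prefixWeight_nonneg_of_stratEnergy_ne_top {X : Type*} {w : X → X → ℤ} {f : X → X}
    {s : X} {L : ℕ} (hs : f^[L] s = s) (h : stratEnergy w f s ≠ ⊤) :
    0 ≤ prefixWeight w f s L := by
  obtain ⟨B, hB⟩ := (stratEnergy_ne_top_iff w f s).1 h
  by_contra! hneg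
  have := hB ((-B + 1).toNat * L)
  rw [prefixWeight_mul_of_isPeriodicPt w hs] at this
  have hge : -B + 1 ≤ ((-B + 1).toNat : ℤ) := Int.self_le_toNat _
  nlinarith [Int.natCast_nonneg (-B + 1).toNat]

theorem stratEnergy_ne_top_of_prefixWeight_nonneg {X : Type*} {w : X → X → ℤ} {f : X → X}
    {s : X} {L : ℕ} (hL : 0 < L) (hs : f^[L] s = s) (h : 0 ≤ prefixWeight w f s L) :
    stratEnergy w f s ≠ ⊤ := by
  rw [stratEnergy_ne_top_iff]
  obtain ⟨B, hB⟩ := ((Finset.range L).finite_toSet.image (prefixWeight w f s)).bddBelow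
  refine ⟨B, fun i => ?_⟩
  have hk : f^[i / L * L] s = s := by
    rw [mul_comm]
    exact (show Function.IsPeriodicPt f L s from hs).mul_const _
  have hr : B ≤ prefixWeight w f s (i % L) :=
    hB ⟨i % L, by simpa using Nat.mod_lt i hL, rfl⟩
  rw [← Nat.div_add_mod' i L, prefixWeight_add, hk, prefixWeight_mul_of_isPeriodicPt w hs]
  have : 0 ≤ ((i / L : ℕ) : ℤ) * prefixWeight w f s L := by positivity
  linarith

theorem iterate_injOn_of_first {X : Type*} {f : X → X} {s : X} {p : X → Prop} {i : ℕ}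
    (hi : p (f^[i] s)) (hmin : ∀ j < i, ¬ p (f^[j] s)) :
    Set.InjOn (fun j => f^[j] s) (Finset.range (i + 1) : Set ℕ) := by
  have key : ∀ a b, a < b → b ≤ i → f^[a] s ≠ f^[b] s := by
    intro a b hab hbi heq
    refine hmin (i - b + a) (by omega) ?_
    rw [Function.iterate_add_apply, heq, ← Function.iterate_add_apply]
    rwa [Nat.sub_add_cancel hbi]
  intro a ha b hb hab
  simp only [Finset.coe_range, Set.mem_Iio] at ha hb
  rcases lt_trichotomy a b with h | h | h
  · exact absurd hab (key a b h (by omega))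
  · exact h
  · exact absurd hab.symm (key b a h (by omega))

/-! ### Winning in terms of strategies -/

instance instFiniteBobStrategy (G : GameGraph V) : Finite G.BobStrategy :=
  inferInstanceAs (Finite {τ : V → V // ∀ u : V, u ∉ G.VA → (u, τ u) ∈ G.E})

theorem aliceWins_iff (G : GameGraph V) (w : V → V → ℤ) (s : V) :
    G.AliceWins w s ↔ ∃ σ : G.AliceStrategy, ∀ τ : G.BobStrategy,
      stratEnergy w (G.play σ τ) s ≠ ⊤ := by
  rw [AliceWins, minEnergy, ne_eq, iInf_eq_top, not_forall]
  refine exists_congr fun σ => ⟨fun h τ hτ => h (top_unique (hτ.ge.trans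
    (le_iSup (fun τ : G.BobStrategy => stratEnergy w (G.play σ τ) s) τ))), fun h => ?_⟩
  rcases isEmpty_or_nonempty G.BobStrategy with _ | _
  · simp
  · obtain ⟨τ, hτ⟩ := exists_eq_ciSup_of_finite
      (f := fun τ : G.BobStrategy => stratEnergy w (G.play σ τ) s)
    rw [← hτ]
    exact h τ

theorem play_mem (G : GameGraph V) (σ : G.AliceStrategy) (τ : G.BobStrategy) (x : V) :
    (x, G.play σ τ x) ∈ G.E := by
  unfold play
  split_ifs with h
  · exact σ.2 x h
  · exact τ.2 x h

theorem abs_le_maxAbsW (G : GameGraph V) (w : V → V → ℤ) {x y : V} (h : (x, y) ∈ G.E) :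
    |w x y| ≤ G.maxAbsW w := by
  have : (w x y).natAbs ≤ G.maxAbsW w :=
    Finset.le_sup (f := fun p : V × V => (w p.1 p.2).natAbs) h
  rw [Int.abs_eq_natAbs]
  exact_mod_cast this

/-! ### Transferring strategies between a game and its gadget graph -/

/-- The original node that a gadget node leads to when no back edge is used. -/
def gadgetTarget {G : GameGraph V} : GadgetV G → V
  | Sum.inl y => y
  | Sum.inr (Sum.inl e) => e.1.2
  | Sum.inr (Sum.inr e) => e.1.2

/-- The successor function on the gadget graph that follows `f` and uses no back edge. -/
def gadgetLift (G : GameGraph V) (f : V → V) : GadgetV G → GadgetV G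
  | Sum.inl x => if h : (x, f x) ∈ G.E then Sum.inr (Sum.inl ⟨(x, f x), h⟩) else Sum.inl x
  | Sum.inr (Sum.inl e) => Sum.inr (Sum.inr e)
  | Sum.inr (Sum.inr e) => Sum.inl e.1.2

theorem mem_gadget_E (G : GameGraph V) (s : V) (q : GadgetV G × GadgetV G) :
    q ∈ (gadget G s).E ↔ gadgetEdge G s q = true := by
  simp [gadget]

theorem inl_mem_gadget_VA (G : GameGraph V) (s x : V) :
    Sum.inl x ∈ (gadget G s).VA ↔ x ∈ G.VA := by
  simp [gadget]

theorem left_mem_gadget_VA (G : GameGraph V) (s : V) (e : EdgeSub G) :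
    Sum.inr (Sum.inl e) ∈ (gadget G s).VA := by
  simp [gadget]

theorem right_notMem_gadget_VA (G : GameGraph V) (s : V) (e : EdgeSub G) :
    Sum.inr (Sum.inr e) ∉ (gadget G s).VA := by
  simp [gadget]

theorem eq_left_of_mem_gadget_E {G : GameGraph V} {s x : V} {b : GadgetV G}
    (h : (Sum.inl x, b) ∈ (gadget G s).E) :
    ∃ hx : (x, gadgetTarget b) ∈ G.E, b = Sum.inr (Sum.inl ⟨(x, gadgetTarget b), hx⟩) := by
  rw [mem_gadget_E] at h
  rcases b with y | ⟨⟨a, c⟩, he⟩ | e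
  · simp [gadgetEdge] at h
  · obtain rfl : a = x := by simpa [gadgetEdge] using h
    exact ⟨he, rfl⟩
  · simp [gadgetEdge] at h

theorem eq_of_left_mem_gadget_E {G : GameGraph V} {s : V} {e : EdgeSub G} {b : GadgetV G}
    (h : (Sum.inr (Sum.inl e), b) ∈ (gadget G s).E) :
    b = Sum.inr (Sum.inr e) ∨ b = Sum.inl s := by
  rw [mem_gadget_E] at h
  rcases b with y | e' | e' <;> simp_all [gadgetEdge]

theorem eq_of_right_mem_gadget_E {G : GameGraph V} {s : V} {e : EdgeSub G} {b : GadgetV G}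
    (h : (Sum.inr (Sum.inr e), b) ∈ (gadget G s).E) :
    b = Sum.inl e.1.2 ∨ b = Sum.inl s := by
  rw [mem_gadget_E] at h
  rcases b with y | e' | e'
  · simpa only [gadgetEdge, decide_eq_true_eq, Sum.inl.injEq, @eq_comm V e.1.2] using h
  all_goals simp [gadgetEdge] at h

theorem gadgetLift_inl (G : GameGraph V) {f : V → V} {x : V} (h : (x, f x) ∈ G.E) :
    gadgetLift G f (Sum.inl x) = Sum.inr (Sum.inl ⟨(x, f x), h⟩) :=
  dif_pos h

/-- Alice's strategy on the gadget graph that follows `σ` and uses no back edge. -/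
def AliceStrategy.lift {G : GameGraph V} (s : V) (σ : G.AliceStrategy) :
    (gadget G s).AliceStrategy :=
  ⟨gadgetLift G σ.1, by
    rintro (x | e | e) hu
    · rw [gadgetLift_inl G (σ.2 x ((inl_mem_gadget_VA G s x).1 hu)), mem_gadget_E]
      simp [gadgetEdge]
    · rw [mem_gadget_E]
      simp [gadgetLift, gadgetEdge]
    · exact absurd hu (right_notMem_gadget_VA G s e)⟩

/-- Bob's strategy on the gadget graph that follows `τ` and uses no back edge. -/
def BobStrategy.lift {G : GameGraph V} (s : V) (τ : G.BobStrategy) :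
    (gadget G s).BobStrategy :=
  ⟨gadgetLift G τ.1, by
    rintro (x | e | e) hu
    · rw [gadgetLift_inl G (τ.2 x (mt (inl_mem_gadget_VA G s x).2 hu)), mem_gadget_E]
      simp [gadgetEdge]
    · exact absurd (left_mem_gadget_VA G s e) hu
    · rw [mem_gadget_E]
      simp [gadgetLift, gadgetEdge]⟩

/-- Alice's strategy on the original game that selects the edges selected by `σ`. -/
def AliceStrategy.project {G : GameGraph V} {s : V} (σ : (gadget G s).AliceStrategy) :
    G.AliceStrategy :=
  ⟨fun x => gadgetTarget (σ.1 (Sum.inl x)), fun x hx =>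
    (eq_left_of_mem_gadget_E (σ.2 _ ((inl_mem_gadget_VA G s x).2 hx))).1⟩

/-- Bob's strategy on the original game that selects the edges selected by `τ`. -/
def BobStrategy.project {G : GameGraph V} {s : V} (τ : (gadget G s).BobStrategy) :
    G.BobStrategy :=
  ⟨fun x => gadgetTarget (τ.1 (Sum.inl x)), fun x hx =>
    (eq_left_of_mem_gadget_E (τ.2 _ (mt (inl_mem_gadget_VA G s x).1 hx))).1⟩

theorem play_lift_inl (G : GameGraph V) (s : V) (σ : G.AliceStrategy)
    (τ : (gadget G s).BobStrategy) (x : V) :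
    (gadget G s).play (σ.lift s) τ (Sum.inl x) =
      Sum.inr (Sum.inl ⟨(x, G.play σ τ.project x), G.play_mem σ τ.project x⟩) := by
  by_cases hx : x ∈ G.VA
  · simp only [play, inl_mem_gadget_VA, hx, if_true]
    exact gadgetLift_inl G (σ.2 x hx)
  · simp only [play, inl_mem_gadget_VA, hx, if_false]
    exact (eq_left_of_mem_gadget_E (τ.2 _ (mt (inl_mem_gadget_VA G s x).1 hx))).2

theorem play_inl_lift (G : GameGraph V) (s : V) (σ : (gadget G s).AliceStrategy)
    (τ : G.BobStrategy) (x : V) :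
    (gadget G s).play σ (τ.lift s) (Sum.inl x) =
      Sum.inr (Sum.inl ⟨(x, G.play σ.project τ x), G.play_mem σ.project τ x⟩) := by
  by_cases hx : x ∈ G.VA
  · simp only [play, inl_mem_gadget_VA, hx, if_true]
    exact (eq_left_of_mem_gadget_E (σ.2 _ ((inl_mem_gadget_VA G s x).2 hx))).2
  · simp only [play, inl_mem_gadget_VA, hx, if_false]
    exact gadgetLift_inl G (τ.2 x hx)

/-! ### Plays on the gadget graph -/

section Plays

variable {G : GameGraph V} {w : V → V → ℤ} {s : V} {f : V → V}
  {g : GadgetV G → GadgetV G} {hf : ∀ x, (x, f x) ∈ G.E}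

theorem gadget_iterate_three_mul (hg : ∀ x, g (Sum.inl x) = Sum.inr (Sum.inl ⟨(x, f x), hf x⟩))
    {i : ℕ}
    (hl : ∀ j < i, g (Sum.inr (Sum.inl ⟨(f^[j] s, f (f^[j] s)), hf _⟩)) =
      Sum.inr (Sum.inr ⟨(f^[j] s, f (f^[j] s)), hf _⟩))
    (hr : ∀ j < i, g (Sum.inr (Sum.inr ⟨(f^[j] s, f (f^[j] s)), hf _⟩)) =
      Sum.inl (f (f^[j] s))) :
    g^[3 * i] (Sum.inl s) = Sum.inl (f^[i] s) ∧
      prefixWeight (gadgetW G w s) g (Sum.inl s) (3 * i) = prefixWeight w f s i := by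
  induction i with
  | zero => simp [prefixWeight]
  | succ i ih =>
    obtain ⟨h₁, h₂⟩ := ih (fun j hj => hl j (hj.trans i.lt_succ_self))
      (fun j hj => hr j (hj.trans i.lt_succ_self))
    have hl' := hl i i.lt_succ_self
    have hr' := hr i i.lt_succ_self
    rw [mul_add_one]
    refine ⟨?_, ?_⟩
    · simp only [Function.iterate_succ_apply', h₁, hg, hl', hr']
    · simp only [prefixWeight_succ, Function.iterate_succ_apply', h₁, h₂, hg, hl', hr']
      simp [gadgetW]

theorem gadget_iterate_add_one
    (hg : ∀ x, g (Sum.inl x) = Sum.inr (Sum.inl ⟨(x, f x), hf x⟩)) {i : ℕ}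
    (hi : g^[3 * i] (Sum.inl s) = Sum.inl (f^[i] s))
    (hw : prefixWeight (gadgetW G w s) g (Sum.inl s) (3 * i) = prefixWeight w f s i) :
    g^[3 * i + 1] (Sum.inl s) = Sum.inr (Sum.inl ⟨(f^[i] s, f (f^[i] s)), hf _⟩) ∧
      prefixWeight (gadgetW G w s) g (Sum.inl s) (3 * i + 1) = prefixWeight w f s (i + 1) := by
  simp only [prefixWeight_succ, Function.iterate_succ_apply', hi, hw, hg]
  simp [gadgetW]

theorem gadget_iterate_add_two
    (hg : ∀ x, g (Sum.inl x) = Sum.inr (Sum.inl ⟨(x, f x), hf x⟩)) {i : ℕ}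
    (hi : g^[3 * i] (Sum.inl s) = Sum.inl (f^[i] s))
    (hw : prefixWeight (gadgetW G w s) g (Sum.inl s) (3 * i) = prefixWeight w f s i)
    (hl : g (Sum.inr (Sum.inl ⟨(f^[i] s, f (f^[i] s)), hf _⟩)) =
      Sum.inr (Sum.inr ⟨(f^[i] s, f (f^[i] s)), hf _⟩)) :
    g^[3 * i + 2] (Sum.inl s) = Sum.inr (Sum.inr ⟨(f^[i] s, f (f^[i] s)), hf _⟩) ∧
      prefixWeight (gadgetW G w s) g (Sum.inl s) (3 * i + 2) = prefixWeight w f s (i + 1) := by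
  obtain ⟨h₁, h₂⟩ := gadget_iterate_add_one hg hi hw
  rw [show 3 * i + 2 = 3 * i + 1 + 1 from rfl, prefixWeight_succ, Function.iterate_succ_apply',
    h₁, h₂, hl]
  simp [gadgetW]

theorem stratEnergy_gadget_ne_top (hf : ∀ x, (x, f x) ∈ G.E)
    (hg : ∀ x, g (Sum.inl x) = Sum.inr (Sum.inl ⟨(x, f x), hf x⟩))
    (hl : ∀ e, g (Sum.inr (Sum.inl e)) = Sum.inr (Sum.inr e))
    (hr : ∀ e, g (Sum.inr (Sum.inr e)) = Sum.inl e.1.2 ∨ g (Sum.inr (Sum.inr e)) = Sum.inl s)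
    (h : stratEnergy w f s ≠ ⊤) :
    stratEnergy (gadgetW G w s) g (Sum.inl s) ≠ ⊤ := by
  classical
  let p : V → Prop := fun x => g (Sum.inr (Sum.inr ⟨(x, f x), hf x⟩)) ≠ Sum.inl (f x)
  by_cases hp : ∃ i, p (f^[i] s)
  · obtain ⟨i, hi, hmin⟩ : ∃ i, p (f^[i] s) ∧ ∀ j < i, ¬ p (f^[j] s) :=
      ⟨Nat.find hp, Nat.find_spec hp, fun j hj => Nat.find_min hp hj⟩
    obtain ⟨h₁, h₂⟩ := gadget_iterate_three_mul (w := w) hg (fun j _ => hl _)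
      (fun j hj => not_not.1 (hmin j hj))
    obtain ⟨h₃, h₄⟩ := gadget_iterate_add_two hg h₁ h₂ (hl _)
    have hback := (hr _).resolve_left hi
    have hs : s ≠ f (f^[i] s) := fun hs => hi (by rw [hback, ← hs])
    refine stratEnergy_ne_top_of_prefixWeight_nonneg (L := 3 * i + 2 + 1) (by omega) ?_ ?_
    · rw [Function.iterate_succ_apply', h₃, hback]
    · rw [prefixWeight_succ, h₃, h₄, hback]
      have hcard : i + 1 ≤ Fintype.card V := by
        simpa using Finset.card_le_card_of_injOn (t := Finset.univ) _ (fun _ _ => by simp)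
          (iterate_injOn_of_first hi hmin)
      have hsum : ((i + 1 : ℕ) : ℤ) * -(G.maxAbsW w : ℤ) ≤ prefixWeight w f s (i + 1) := by
        have := Finset.card_nsmul_le_sum (Finset.range (i + 1))
          (fun j => w (f^[j] s) (f^[j + 1] s)) (-(G.maxAbsW w : ℤ)) fun j _ => by
            rw [Function.iterate_succ_apply']
            exact (abs_le.1 (abs_le_maxAbsW G w (hf _))).1
        simpa [prefixWeight] using this
      have hle : ((i + 1 : ℕ) : ℤ) * (G.maxAbsW w : ℤ) ≤
          (Fintype.card V : ℤ) * (G.maxAbsW w : ℤ) := by gcongr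
      simp only [gadgetW, if_neg hs]
      linarith
  · push Not at hp
    obtain ⟨B, hB⟩ := (stratEnergy_ne_top_iff w f s).1 h
    refine (stratEnergy_ne_top_iff _ _ _).2 ⟨B, fun m => ?_⟩
    obtain ⟨h₁, h₂⟩ := gadget_iterate_three_mul (w := w) (i := m / 3) hg (fun j _ => hl _)
      (fun j _ => not_not.1 (hp j))
    obtain h | h | h : m = 3 * (m / 3) ∨ m = 3 * (m / 3) + 1 ∨ m = 3 * (m / 3) + 2 := by omega
    · rw [h, h₂]
      exact hB _
    · rw [h, (gadget_iterate_add_one hg h₁ h₂).2]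
      exact hB _
    · rw [h, (gadget_iterate_add_two hg h₁ h₂ (hl _)).2]
      exact hB _

theorem stratEnergy_ne_top_of_gadget (hf : ∀ x, (x, f x) ∈ G.E)
    (hg : ∀ x, g (Sum.inl x) = Sum.inr (Sum.inl ⟨(x, f x), hf x⟩))
    (hl : ∀ e, g (Sum.inr (Sum.inl e)) = Sum.inr (Sum.inr e) ∨ g (Sum.inr (Sum.inl e)) = Sum.inl s)
    (hr : ∀ e, g (Sum.inr (Sum.inr e)) = Sum.inl e.1.2)
    (h : stratEnergy (gadgetW G w s) g (Sum.inl s) ≠ ⊤) :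
    stratEnergy w f s ≠ ⊤ := by
  classical
  let p : V → Prop := fun x =>
    g (Sum.inr (Sum.inl ⟨(x, f x), hf x⟩)) ≠ Sum.inr (Sum.inr ⟨(x, f x), hf x⟩)
  have hW : ∀ x, w x (f x) ≤ G.maxAbsW w := fun x =>
    (abs_le.1 (abs_le_maxAbsW G w (hf x))).2
  by_cases hp : ∃ i, p (f^[i] s)
  · obtain ⟨i, hi, hmin⟩ : ∃ i, p (f^[i] s) ∧ ∀ j < i, ¬ p (f^[j] s) :=
      ⟨Nat.find hp, Nat.find_spec hp, fun j hj => Nat.find_min hp hj⟩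
    have hinj := iterate_injOn_of_first hi hmin
    obtain ⟨h₁, h₂⟩ := gadget_iterate_three_mul (w := w) hg (fun j hj => not_not.1 (hmin j hj))
      (fun j _ => hr _)
    obtain ⟨h₃, h₄⟩ := gadget_iterate_add_one hg h₁ h₂
    have hback := (hl _).resolve_left hi
    have hcyc := prefixWeight_nonneg_of_stratEnergy_ne_top (L := 3 * i + 1 + 1)
      (by rw [Function.iterate_succ_apply', h₃, hback]) h
    rw [prefixWeight_succ, h₃, h₄, hback] at hcyc
    simp only [gadgetW] at hcyc
    -- The closed play has weight at most zero, so each of its original edges has maximal weight.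
    have hcard : i + 1 ≤ Fintype.card V := by
      simpa using Finset.card_le_card_of_injOn (t := Finset.univ) _ (fun _ _ => by simp) hinj
    have hsum : ∑ x ∈ (Finset.range (i + 1)).image (fun j => f^[j] s), w x (f x) =
        prefixWeight w f s (i + 1) := by
      rw [Finset.sum_image hinj]
      simp only [prefixWeight, Function.iterate_succ_apply']
    have himage : ((Finset.range (i + 1)).image (fun j => f^[j] s)).card = i + 1 := by
      rw [Finset.card_image_of_injOn hinj, Finset.card_range]
    have hnonneg : ∀ x, 0 ≤ w x (f x) := by
      rcases Nat.eq_zero_or_pos (G.maxAbsW w) with h0 | hpos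
      · intro x
        have := (abs_le.1 (abs_le_maxAbsW G w (hf x))).1
        simpa [h0] using this
      · have hle : prefixWeight w f s (i + 1) ≤ ((i + 1 : ℕ) : ℤ) * (G.maxAbsW w : ℤ) := by
          have := Finset.sum_le_card_nsmul ((Finset.range (i + 1)).image fun j => f^[j] s)
            (fun x => w x (f x)) (G.maxAbsW w : ℤ) fun x _ => hW x
          rwa [hsum, himage, nsmul_eq_mul] at this
        have hn : Fintype.card V = i + 1 := by
          refine le_antisymm ?_ hcard
          have : (Fintype.card V : ℤ) * (G.maxAbsW w : ℤ) ≤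
              ((i + 1 : ℕ) : ℤ) * (G.maxAbsW w : ℤ) := by linarith
          exact_mod_cast le_of_mul_le_mul_right this (by exact_mod_cast hpos)
        have huniv : (Finset.range (i + 1)).image (fun j => f^[j] s) = Finset.univ :=
          Finset.eq_univ_of_card _ (himage.trans hn.symm)
        rw [huniv] at hsum
        have htight : ∑ x, w x (f x) = ∑ _x : V, (G.maxAbsW w : ℤ) := by
          refine le_antisymm (Finset.sum_le_sum fun x _ => hW x) ?_
          simp only [Finset.sum_const, Finset.card_univ, nsmul_eq_mul]
          linarith
        intro x
        rw [(Finset.sum_eq_sum_iff_of_le fun x _ => hW x).1 htight x (Finset.mem_univ x)]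
        positivity
    refine (stratEnergy_ne_top_iff _ _ _).2 ⟨0, fun m => Finset.sum_nonneg fun j _ => ?_⟩
    rw [Function.iterate_succ_apply']
    exact hnonneg _
  · push Not at hp
    obtain ⟨B, hB⟩ := (stratEnergy_ne_top_iff _ _ _).1 h
    refine (stratEnergy_ne_top_iff _ _ _).2 ⟨B, fun m => ?_⟩
    rw [← (gadget_iterate_three_mul (w := w) hg (fun j _ => not_not.1 (hp j))
      (fun j _ => hr _)).2]
    exact hB _

end Plays

/-- Alice wins at `s` in `(G,w)` iff Alice wins at `s` in the gadget graph
`(G',w')` obtained from `(G,w)` and `s`. -/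
theorem gadget_preserves_winner_at_start (G : GameGraph V) (w : V → V → ℤ) (s : V) :
    G.AliceWins w s ↔ (gadget G s).AliceWins (gadgetW G w s) (Sum.inl s) := by
  rw [aliceWins_iff, aliceWins_iff]
  constructor
  · rintro ⟨σ, hσ⟩
    refine ⟨σ.lift s, fun τ => stratEnergy_gadget_ne_top (G.play_mem σ τ.project)
      (play_lift_inl G s σ τ) (fun e => ?_) (fun e => ?_) (hσ τ.project)⟩
    · exact if_pos (left_mem_gadget_VA G s e)
    · exact eq_of_right_mem_gadget_E ((gadget G s).play_mem _ _ _)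
  · rintro ⟨σ, hσ⟩
    refine ⟨σ.project, fun τ => stratEnergy_ne_top_of_gadget (G.play_mem σ.project τ)
      (play_inl_lift G s σ τ) (fun e => ?_) (fun e => ?_) (hσ (τ.lift s))⟩
    · exact eq_of_left_mem_gadget_E ((gadget G s).play_mem _ _ _)
    · exact if_neg (right_notMem_gadget_VA G s e)

end GameGraph
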